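/- arXiv:1104.3960 — 2 statements merged into one kernel-verified Lean document; each statement's English description precedes it below -/
import Mathlib

section
/- Let γ > 0, α > −1, 1 < q < ∞, and 1 < p < ∞. There exists a constant C > 0, depending only on γ, q, α, p, n, such that ‖A_γ^{(q)}(f)‖_{L^p(dv_α)} ≤ C ‖f‖_{p,α} for every f ∈ A^p_α, where A_γ^{(q)}(f)(z) = (∫_{D(z,γ)} |f(w)|^q dτ(w))^{1/q}. -/
open MeasureTheory Filter Topology
open scoped Classical ENNReal

noncomputable section

/-- `ℂⁿ` with the Euclidean norm. -/
abbrev En (n : ℕ) := EuclideanSpace ℂ (Fin n)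

instance (n : ℕ) : MeasurableSpace (En n) := borel _
instance (n : ℕ) : BorelSpace (En n) := ⟨rfl⟩

/-- The Lebesgue volume measure on `ℂⁿ`. -/
def vol (n : ℕ) : Measure (En n) := Measure.addHaar

/-- The open unit ball `𝔹ₙ` of `ℂⁿ`. -/
def uball (n : ℕ) : Set (En n) := Metric.ball 0 1

/-- The Hermitian pairing `⟨z,w⟩ = ∑ⱼ zⱼ * conj wⱼ`. -/
def herm {n : ℕ} (z w : En n) : ℂ := ∑ j, z j * (starRingEnd ℂ) (w j)

/-- The orthogonal projection `P_z w` onto the line spanned by `z`. -/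
def prj {n : ℕ} (z w : En n) : En n :=
  if z = 0 then 0 else (herm w z / herm z z) • z

/-- The Möbius automorphism `φ_z` of the unit ball. -/
def mobius {n : ℕ} (z w : En n) : En n :=
  ((1 : ℂ) / (1 - herm w z)) •
    (z - prj z w - ((Real.sqrt (1 - ‖z‖ ^ 2) : ℝ) : ℂ) • (w - prj z w))

/-- The Bergman metric `β(z,w)`. -/
def bmet {n : ℕ} (z w : En n) : ℝ :=
  (1 / 2) * Real.log ((1 + ‖mobius z w‖) / (1 - ‖mobius z w‖))

/-- The Bergman metric ball `D(z,γ)`. -/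
def Dball {n : ℕ} (z : En n) (γ : ℝ) : Set (En n) :=
  {w | w ∈ uball n ∧ bmet z w < γ}

/-- The normalizing constant `c_α`. -/
def cnorm (n : ℕ) (α : ℝ) : ℝ :=
  if -1 < α then Real.Gamma (n + α + 1) / (n.factorial * Real.Gamma (α + 1)) else 1

/-- The weighted measure `dv_α = c_α (1-|z|²)^α dv` on the unit ball. -/
def measA (n : ℕ) (α : ℝ) : Measure (En n) :=
  ((vol n).restrict (uball n)).withDensity
    (fun z => ENNReal.ofReal (cnorm n α * (1 - ‖z‖ ^ 2) ^ α))

/-- The invariant measure `dτ = (1-|z|²)^{-(n+1)} dv` on the unit ball. -/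
def measTau (n : ℕ) : Measure (En n) :=
  ((vol n).restrict (uball n)).withDensity
    (fun z => ENNReal.ofReal ((1 - ‖z‖ ^ 2) ^ (-((n : ℝ) + 1))))

/-- The Bergman space (quasi-)norm `‖f‖_{p,α}`, valued in `ℝ≥0∞`. -/
def apnorm (n : ℕ) (p α : ℝ) (f : En n → ℂ) : ℝ≥0∞ :=
  (∫⁻ z, ENNReal.ofReal (‖f z‖ ^ p) ∂measA n α) ^ (1 / p)

/-- The radial derivative `Rf(z) = ∑ z_k ∂f/∂z_k = Df(z)[z]`. -/
def radD {n : ℕ} (f : En n → ℂ) (z : En n) : ℂ := fderiv ℂ f z z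

/-- Iterated radial derivative `R^k f`. -/
def radIter {n : ℕ} : ℕ → (En n → ℂ) → En n → ℂ
  | 0, f => f
  | (k + 1), f => radD (radIter k f)

/-- The pseudo-metric `ϱ` on the unit ball. -/
def rho {n : ℕ} (z w : En n) : ℝ :=
  if z ≠ 0 ∧ w ≠ 0 then
    |‖z‖ - ‖w‖| + ‖1 - herm z w / ((‖z‖ : ℂ) * (‖w‖ : ℂ))‖
  else ‖z‖ + ‖w‖

/-- The area integral `A_γ^{(q)} g(z) = (∫_{D(z,γ)} g(w)^q dτ(w))^{1/q}`, valued in `ℝ≥0∞`. -/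
def areaF {n : ℕ} (γ q : ℝ) (g : En n → ℝ) (z : En n) : ℝ≥0∞ :=
  (∫⁻ w in Dball z γ, ENNReal.ofReal (g w) ^ q ∂measTau n) ^ (1 / q)

section Gen

variable {E : Type*} [NormedAddCommGroup E] [InnerProductSpace ℂ E]

def sfun (z : E) : ℝ := 1 - ‖z‖ ^ 2

def NN (C : ℝ) (z w : E) : Prop :=
  ‖z‖ < 1 ∧ ‖w‖ < 1 ∧ ‖1 - inner ℂ z w‖ ≤ C * sfun z ∧ ‖1 - inner ℂ z w‖ ≤ C * sfun w

lemma sfun_pos {z : E} (hz : ‖z‖ < 1) : 0 < sfun z := by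
  unfold sfun; nlinarith [norm_nonneg z]

lemma norm_one_sub_inner_symm (z w : E) : ‖1 - inner ℂ z w‖ = ‖1 - inner ℂ w z‖ := by
  rw [← inner_conj_symm w z, ← Complex.norm_conj]; simp

lemma NN.symm {C : ℝ} {z w : E} (h : NN C z w) : NN C w z := by
  obtain ⟨h1, h2, h3, h4⟩ := h
  rw [norm_one_sub_inner_symm] at h3 h4
  exact ⟨h2, h1, h4, h3⟩

lemma sfun_le {z w : E} (hz : ‖z‖ < 1) (hw : ‖w‖ < 1) : sfun w ≤ 2 * ‖1 - inner ℂ z w‖ := by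
  have h1 : ‖(inner ℂ z w : ℂ)‖ ≤ ‖z‖ * ‖w‖ := norm_inner_le_norm z w
  have h2 : 1 - ‖(inner ℂ z w : ℂ)‖ ≤ ‖1 - inner ℂ z w‖ := by
    have := norm_sub_norm_le (1 : ℂ) (inner ℂ z w); simpa using this
  unfold sfun
  nlinarith [norm_nonneg z, norm_nonneg w]

lemma NN.sfun_le {C : ℝ} {z w : E} (h : NN C z w) : sfun w ≤ 2 * C * sfun z := by
  obtain ⟨h1, h2, h3, h4⟩ := h
  have := _root_.sfun_le h1 h2
  nlinarith

lemma norm_sub_sq_le {z w : E} (hz : ‖z‖ < 1) (hw : ‖w‖ < 1) :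
    ‖z - w‖ ^ 2 ≤ 2 * ‖1 - inner ℂ z w‖ := by
  have h := @norm_sub_sq ℂ E _ _ _ z w
  have h2 : 1 - RCLike.re (inner ℂ z w : ℂ) ≤ ‖1 - inner ℂ z w‖ := by
    have := Complex.re_le_norm (1 - inner ℂ z w); simpa using this
  rw [h]
  nlinarith [norm_nonneg z, norm_nonneg w]

lemma NN.comp {C C' : ℝ} {z w u : E} (hC : 0 ≤ C) (hC' : 0 ≤ C') (h : NN C z w) (h' : NN C' w u) :
    NN (4 * C + 4 * C' + 4 * C * C') z u := by
  obtain ⟨h1, h2, h3, h4⟩ := h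
  obtain ⟨_, k2, k3, k4⟩ := h'
  have e : (1 : ℂ) - inner ℂ z u = (1 - inner ℂ z w) + (1 - inner ℂ w u) - ((sfun w : ℝ) : ℂ)
      - inner ℂ (z - w) (u - w) := by
    simp only [inner_sub_left, inner_sub_right, sfun]
    rw [inner_self_eq_norm_sq_to_K]
    push_cast
    simp
    ring
  have n1 := norm_sub_sq_le h1 h2
  have n2 := norm_sub_sq_le h2 k2
  rw [norm_sub_rev w u] at n2
  have i1 : ‖(inner ℂ (z - w) (u - w) : ℂ)‖ ≤ ‖z - w‖ * ‖u - w‖ := norm_inner_le_norm _ _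
  have sw := sfun_pos h2
  have s1 := _root_.sfun_le h1 h2
  have s2 := _root_.sfun_le k2 h2
  rw [norm_one_sub_inner_symm] at s2
  have t : ‖1 - inner ℂ z u‖ ≤ ‖1 - inner ℂ z w‖ + ‖1 - inner ℂ w u‖ + sfun w
      + ‖(inner ℂ (z - w) (u - w) : ℂ)‖ := by
    rw [e]
    refine (norm_sub_le _ _).trans ?_
    gcongr
    refine (norm_sub_le _ _).trans ?_
    gcongr
    · exact norm_add_le _ _
    · simp [abs_of_pos sw]
  set a := ‖1 - inner ℂ z w‖
  set b := ‖1 - inner ℂ w u‖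
  have t2 : ‖1 - inner ℂ z u‖ ≤ 2 * a + 2 * b + sfun w := by
    nlinarith [sq_nonneg (‖z - w‖ - ‖u - w‖)]
  have ha : 0 ≤ a := norm_nonneg _
  have hb : 0 ≤ b := norm_nonneg _
  have sz := sfun_pos h1
  have su := sfun_pos k2
  refine ⟨h1, k2, ?_, ?_⟩
  · have : b ≤ 2 * C' * (C * sfun z) := by
      calc b ≤ C' * sfun w := k3
        _ ≤ C' * (2 * a) := by gcongr
        _ ≤ C' * (2 * (C * sfun z)) := by gcongr
        _ = _ := by ring
    have := mul_nonneg hC' sz.le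
    nlinarith
  · have : a ≤ 2 * C * (C' * sfun u) := by
      calc a ≤ C * sfun w := h4
        _ ≤ C * (2 * b) := by gcongr
        _ ≤ C * (2 * (C' * sfun u)) := by gcongr
        _ = _ := by ring
    have := mul_nonneg hC su.le
    nlinarith

/-- rank-one perturbation `v ↦ a (v + b ⟨z,v⟩ z)` -/
def RR (a b : ℝ) (z : E) : E →ₗ[ℂ] E :=
  (a : ℂ) • LinearMap.transvection (innerₛₗ ℂ z) ((b : ℂ) • z)

lemma RR_apply (a b : ℝ) (z v : E) : RR a b z v = (a : ℂ) • (v + (inner ℂ z v * (b : ℂ)) • z) := by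
  rw [RR, LinearMap.smul_apply, LinearMap.transvection.apply, smul_smul]; rfl

lemma RR_det [FiniteDimensional ℂ E] (a b : ℝ) (z : E) :
    LinearMap.det ((RR a b z).restrictScalars ℝ) =
      (a ^ (Module.finrank ℂ E) * (1 + b * ‖z‖ ^ 2)) ^ 2 := by
  rw [LinearMap.det_restrictScalars, RR, LinearMap.det_smul, LinearMap.transvection.det,
    Algebra.norm_complex_apply]
  have : (innerₛₗ ℂ z) ((b : ℂ) • z) = ((b * ‖z‖ ^ 2 : ℝ) : ℂ) := by
    simp [inner_smul_right, inner_self_eq_norm_sq_to_K]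
  rw [this]
  have : (a : ℂ) ^ Module.finrank ℂ E * (1 + ((b * ‖z‖ ^ 2 : ℝ) : ℂ)) =
    ((a ^ (Module.finrank ℂ E) * (1 + b * ‖z‖ ^ 2) : ℝ) : ℂ) := by push_cast; ring
  rw [this, Complex.normSq_ofReal]; ring

end Gen
section Gen2

variable {E : Type*} [NormedAddCommGroup E] [InnerProductSpace ℂ E]
  [FiniteDimensional ℂ E] [MeasurableSpace E] [BorelSpace E]

lemma finReal : FiniteDimensional ℝ E := Module.Finite.trans ℂ E

lemma secCount : SecondCountableTopology E := by
  have : ProperSpace E := FiniteDimensional.proper ℂ E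
  infer_instance

lemma measSet_NN (C : ℝ) : MeasurableSet {x : E × E | NN C x.1 x.2} := by
  have : SecondCountableTopology E := secCount
  have h1 : MeasurableSet {x : E × E | ‖x.1‖ < 1} :=
    (isOpen_lt (by fun_prop) (by fun_prop)).measurableSet
  have h2 : MeasurableSet {x : E × E | ‖x.2‖ < 1} :=
    (isOpen_lt (by fun_prop) (by fun_prop)).measurableSet
  have h3 : MeasurableSet {x : E × E | ‖1 - inner ℂ x.1 x.2‖ ≤ C * (1 - ‖x.1‖ ^ 2)} :=
    (isClosed_le (by fun_prop) (by fun_prop)).measurableSet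
  have h4 : MeasurableSet {x : E × E | ‖1 - inner ℂ x.1 x.2‖ ≤ C * (1 - ‖x.2‖ ^ 2)} :=
    (isClosed_le (by fun_prop) (by fun_prop)).measurableSet
  exact h1.inter (h2.inter (h3.inter h4))

lemma measSet_NN' (C : ℝ) (z : E) : MeasurableSet {w : E | NN C z w} :=
  measurable_prodMk_left (measSet_NN C)

lemma circ_le (G : E → ℂ) (hG : DifferentiableOn ℂ G (Metric.ball 0 2)) (v : E) (hv : ‖v‖ < 1) :
    ‖G 0‖ₑ * ENNReal.ofReal (2 * Real.pi) ≤
      ∫⁻ θ in Set.Ioc 0 (2 * Real.pi), ‖G (circleMap 0 1 θ • v)‖ₑ := by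
  have hmaps : ∀ x ∈ Metric.closedBall (0 : ℂ) |1|, x • v ∈ Metric.ball (0 : E) 2 := by
    intro x hx
    simp only [abs_one, Metric.mem_closedBall, dist_zero_right] at hx
    simp only [Metric.mem_ball, dist_zero_right, norm_smul]
    nlinarith [norm_nonneg v, norm_nonneg x]
  have hd : DifferentiableOn ℂ (fun x : ℂ => G (x • v)) (Metric.closedBall 0 |1|) :=
    hG.comp (by fun_prop) hmaps
  have h := circleAverage_of_differentiable_on_off_countable (f := fun x : ℂ => G (x • v))
    (c := 0) (R := 1) (s := ∅) Set.countable_empty hd.continuousOn (by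
      intro x hx
      refine (hd x ?_).differentiableAt ?_
      · exact Metric.ball_subset_closedBall hx.1
      · exact mem_of_superset (Metric.isOpen_ball.mem_nhds hx.1) Metric.ball_subset_closedBall)
  rw [Real.circleAverage_def, intervalIntegral.integral_of_le Real.two_pi_pos.le] at h
  simp only [zero_smul] at h
  have h2 : ((2 * Real.pi : ℝ)) • G 0 =
      ∫ θ in Set.Ioc 0 (2 * Real.pi), G (circleMap 0 1 θ • v) := by
    rw [← h, smul_smul, mul_inv_cancel₀ Real.two_pi_pos.ne', one_smul]
  calc ‖G 0‖ₑ * ENNReal.ofReal (2 * Real.pi) = ‖((2 * Real.pi : ℝ)) • G 0‖ₑ := by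
        rw [enorm_smul, mul_comm, Real.enorm_of_nonneg Real.two_pi_pos.le]
    _ ≤ _ := by rw [h2]; exact enorm_integral_le_lintegral_enorm _

lemma meas_rot (μ : Measure E) [μ.IsAddHaarMeasure] (c : ℂ) (hc : ‖c‖ = 1) (H : E → ℝ≥0∞)
    (hH : Measurable H) : ∫⁻ v, H (c • v) ∂μ = ∫⁻ v, H v ∂μ := by
  have : FiniteDimensional ℝ E := finReal
  have hdet : LinearMap.det ((c • (LinearMap.id : E →ₗ[ℂ] E)).restrictScalars ℝ) = 1 := by
    rw [LinearMap.det_restrictScalars, LinearMap.det_smul, Algebra.norm_complex_apply]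
    simp [Complex.normSq_eq_norm_sq, hc]
  have hm := Measure.map_linearMap_addHaar_eq_smul_addHaar μ
    (f := (c • (LinearMap.id : E →ₗ[ℂ] E)).restrictScalars ℝ) (by rw [hdet]; norm_num)
  rw [hdet] at hm
  simp only [inv_one, abs_one, ENNReal.ofReal_one, one_smul] at hm
  have := lintegral_map (μ := μ) hH (g := (c • (LinearMap.id : E →ₗ[ℂ] E)).restrictScalars ℝ)
    (LinearMap.continuous_of_finiteDimensional _).measurable
  rw [hm] at this
  rw [this]; rfl

lemma meas_ind (G : E → ℂ) (r : ℝ) (hG : ContinuousOn G (Metric.ball 0 r)) :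
    Measurable ((Metric.ball (0 : E) r).indicator G) := by
  have : SecondCountableTopology E := secCount
  rw [← Set.piecewise_eq_indicator]
  exact hG.measurable_piecewise continuousOn_const Metric.isOpen_ball.measurableSet

lemma submean1 (μ : Measure E) [μ.IsAddHaarMeasure] (G : E → ℂ)
    (hG : DifferentiableOn ℂ G (Metric.ball 0 2)) :
    ‖G 0‖ₑ * μ (Metric.ball 0 1) ≤ ∫⁻ v in Metric.ball 0 1, ‖G v‖ₑ ∂μ := by
  have : SecondCountableTopology E := secCount
  have : ProperSpace E := FiniteDimensional.proper ℂ E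
  set H : E → ℝ≥0∞ := fun v => ‖(Metric.ball (0 : E) 1).indicator G v‖ₑ with hH
  have hHm : Measurable H :=
    (meas_ind G 1 (hG.continuousOn.mono (Metric.ball_subset_ball (by norm_num)))).enorm
  have hB : MeasurableSet (Metric.ball (0 : E) 1) := Metric.isOpen_ball.measurableSet
  have e1 : ∫⁻ v in Metric.ball 0 1, ‖G v‖ₑ ∂μ = ∫⁻ v, H v ∂μ := by
    rw [← lintegral_indicator hB]
    congr 1; ext v
    simp only [hH, Set.indicator]
    split_ifs <;> simp
  have e2 : ∫⁻ v in Metric.ball 0 1, ‖G 0‖ₑ * ENNReal.ofReal (2 * Real.pi) ∂μ ≤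
      ∫⁻ v, (∫⁻ θ in Set.Ioc (0 : ℝ) (2 * Real.pi), H (circleMap 0 1 θ • v)) ∂μ := by
    rw [← lintegral_indicator hB]
    apply lintegral_mono
    intro v
    by_cases hv : v ∈ Metric.ball (0 : E) 1
    · simp only [Set.indicator_of_mem hv]
      have hv' : ‖v‖ < 1 := by simpa using hv
      refine (circ_le G hG v hv').trans (le_of_eq ?_)
      congr 1; ext θ
      rw [hH]
      simp only
      rw [Set.indicator_of_mem]
      simpa [norm_smul] using hv
    · simp [Set.indicator_of_notMem hv]
  have e3 : ∫⁻ v, (∫⁻ θ in Set.Ioc (0 : ℝ) (2 * Real.pi), H (circleMap 0 1 θ • v)) ∂μ =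
      ENNReal.ofReal (2 * Real.pi) * ∫⁻ v, H v ∂μ := by
    rw [lintegral_lintegral_swap]
    · have : ∀ θ : ℝ, ∫⁻ v, H (circleMap 0 1 θ • v) ∂μ = ∫⁻ v, H v ∂μ := fun θ =>
        meas_rot μ _ (by simp) H hHm
      simp only [this]
      rw [lintegral_const]
      simp [mul_comm]
    · apply Measurable.aemeasurable
      apply hHm.comp
      apply Continuous.measurable
      have := continuous_circleMap 0 1
      fun_prop
  rw [e3, lintegral_const, ← e1] at e2
  simp only [MeasurableSet.univ, Measure.restrict_apply, Set.univ_inter] at e2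
  have hpi : ENNReal.ofReal (2 * Real.pi) ≠ 0 := by simp [Real.pi_pos]
  rw [mul_right_comm, mul_comm] at e2
  exact (ENNReal.mul_le_mul_iff_right hpi ENNReal.ofReal_ne_top).1 e2

lemma submeanp (μ : Measure E) [μ.IsAddHaarMeasure] (G : E → ℂ) (p : ℝ) (hp : 1 < p)
    (hG : DifferentiableOn ℂ G (Metric.ball 0 2)) :
    ‖G 0‖ₑ ^ p * μ (Metric.ball 0 1) ≤ ∫⁻ v in Metric.ball 0 1, ‖G v‖ₑ ^ p ∂μ := by
  have : ProperSpace E := FiniteDimensional.proper ℂ E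
  have : SecondCountableTopology E := secCount
  have h1 := submean1 μ G hG
  have hB : MeasurableSet (Metric.ball (0 : E) 1) := Metric.isOpen_ball.measurableSet
  have hq := Real.HolderConjugate.conjExponent hp
  have hm : AEMeasurable (fun v => ‖G v‖ₑ) (μ.restrict (Metric.ball 0 1)) :=
    ((hG.continuousOn.mono (Metric.ball_subset_ball (by norm_num))).aemeasurable hB).enorm
  have h2 := ENNReal.lintegral_mul_le_Lp_mul_Lq (μ.restrict (Metric.ball 0 1)) hq hm
    (g := fun _ => 1) aemeasurable_const
  simp only [Pi.mul_apply, mul_one, ENNReal.one_rpow, lintegral_const, one_mul,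
    MeasurableSet.univ, Measure.restrict_apply, Set.univ_inter] at h2
  set V := μ (Metric.ball (0 : E) 1) with hV
  have V0 : V ≠ 0 := (Metric.measure_ball_pos μ 0 one_pos).ne'
  have Vt : V ≠ ⊤ := measure_ball_lt_top.ne
  set I := ∫⁻ v in Metric.ball 0 1, ‖G v‖ₑ ^ p ∂μ
  have h3 := h1.trans h2
  have hc : V = V ^ (1 / p) * V ^ (1 / Real.conjExponent p) := by
    rw [← ENNReal.rpow_add _ _ V0 Vt, one_div, one_div, hq.inv_add_inv_eq_one, ENNReal.rpow_one]
  nth_rewrite 1 [hc] at h3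
  rw [← mul_assoc] at h3
  have hne : V ^ (1 / Real.conjExponent p) ≠ 0 := by
    simp [V0, Vt]
  have hnt : V ^ (1 / Real.conjExponent p) ≠ ⊤ := ENNReal.rpow_ne_top_of_ne_zero V0 Vt
  have h4 := (ENNReal.mul_le_mul_iff_left hne hnt).1 h3
  have p0 : 0 < p := by linarith
  have h5 := ENNReal.rpow_le_rpow h4 p0.le
  rw [ENNReal.mul_rpow_of_nonneg _ _ p0.le, ← ENNReal.rpow_mul, ← ENNReal.rpow_mul,
    one_div_mul_cancel p0.ne', ENNReal.rpow_one, ENNReal.rpow_one] at h5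
  exact h5

end Gen2
section Gen3

variable {E : Type*} [NormedAddCommGroup E] [InnerProductSpace ℂ E]
  [FiniteDimensional ℂ E] [MeasurableSpace E] [BorelSpace E]

lemma vol_NN (μ : Measure E) [μ.IsAddHaarMeasure] (C : ℝ) (hC : 0 ≤ C) :
    ∃ K : ℝ≥0∞, K < ⊤ ∧ ∀ z : E, ‖z‖ < 1 →
      μ {w | NN C z w} ≤ K * ENNReal.ofReal (sfun z ^ ((Module.finrank ℂ E : ℝ) + 1)) := by
  have : FiniteDimensional ℝ E := finReal
  have : ProperSpace E := FiniteDimensional.proper ℂ E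
  refine ⟨μ (Metric.ball 0 (√(2 * C) + C + 2)), measure_ball_lt_top, ?_⟩
  intro z hz
  have hs := sfun_pos hz
  set t := √(sfun z) with ht
  have t0 : 0 < t := Real.sqrt_pos.2 hs
  have tt : t ^ 2 = sfun z := Real.sq_sqrt hs.le
  have hzt : ‖z‖ ^ 2 = 1 - t ^ 2 := by rw [tt, sfun]; ring
  set S := (RR t⁻¹ (t⁻¹ / (1 + t)) z).restrictScalars ℝ with hS
  have hdet : LinearMap.det S = (sfun z ^ (Module.finrank ℂ E + 1))⁻¹ := by
    rw [hS, RR_det, hzt, ← tt]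
    have : 1 + t⁻¹ / (1 + t) * (1 - t ^ 2) = t⁻¹ := by
      field_simp; ring
    rw [this, ← pow_succ, ← inv_pow, ← inv_pow, ← pow_mul, ← pow_mul, mul_comm]
  have hdet0 : LinearMap.det S ≠ 0 := by rw [hdet]; positivity
  have hsub : {w | NN C z w} ⊆ (fun w => w + -z) ⁻¹' (S ⁻¹' Metric.ball 0 (√(2 * C) + C + 2)) := by
    intro w hw
    obtain ⟨h1, h2, h3, h4⟩ := hw
    simp only [Set.mem_preimage, Metric.mem_ball, dist_zero_right, ← sub_eq_add_neg]
    have e : S (w - z) = ((t⁻¹ : ℝ) : ℂ) • ((w - z) + (inner ℂ z (w - z) * ((t⁻¹ / (1 + t) : ℝ) : ℂ)) • z) :=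
      RR_apply _ _ _ _
    have b1 : ‖w - z‖ ≤ t * √(2 * C) := by
      rw [norm_sub_rev]
      apply le_of_sq_le_sq _ (by positivity)
      rw [mul_pow, tt, Real.sq_sqrt (by positivity)]
      have := norm_sub_sq_le h1 h2
      linarith
    have b2 : ‖(inner ℂ z (w - z) : ℂ)‖ ≤ (C + 1) * t ^ 2 := by
      have : (inner ℂ z (w - z) : ℂ) = ((sfun z : ℝ) : ℂ) - (1 - inner ℂ z w) := by
        rw [inner_sub_right, inner_self_eq_norm_sq_to_K, sfun]; push_cast; simp
      rw [this]
      refine (norm_sub_le _ _).trans ?_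
      rw [Complex.norm_real, Real.norm_of_nonneg hs.le, tt]
      linarith
    have b3 : ‖S (w - z)‖ ≤ t⁻¹ * (t * √(2 * C) + (C + 1) * t ^ 2 * t⁻¹ * 1) := by
      rw [e, norm_smul, Complex.norm_real, Real.norm_of_nonneg (by positivity)]
      gcongr
      refine (norm_add_le _ _).trans ?_
      gcongr
      rw [norm_smul, norm_mul, Complex.norm_real, Real.norm_of_nonneg (by positivity)]
      gcongr
      exact div_le_self (by positivity) (by linarith)
    have b4 : t⁻¹ * (t * √(2 * C) + (C + 1) * t ^ 2 * t⁻¹ * 1) = √(2 * C) + C + 1 := by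
      field_simp; ring
    linarith
  refine (measure_mono hsub).trans ?_
  rw [measure_preimage_add_right, Measure.addHaar_preimage_linearMap μ hdet0, hdet, inv_inv,
    abs_of_nonneg (by positivity), mul_comm]
  gcongr
  rw [← Nat.cast_succ, Real.rpow_natCast]

lemma ell_NN (w v : E) (hw : ‖w‖ < 1) (hv : ‖v‖ < 2) :
    NN 2 w (w + RR (16⁻¹ * √(sfun w)) (-(1 + √(sfun w))⁻¹) w v) := by
  have hs := sfun_pos hw
  set t := √(sfun w) with ht
  have t0 : 0 < t := Real.sqrt_pos.2 hs
  have tt : t ^ 2 = sfun w := Real.sq_sqrt hs.le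
  have hzt : ‖w‖ ^ 2 = 1 - t ^ 2 := by rw [tt, sfun]; ring
  set x := RR (16⁻¹ * t) (-(1 + t)⁻¹) w v with hx
  have e : x = ((16⁻¹ * t : ℝ) : ℂ) • (v + (inner ℂ w v * ((-(1 + t)⁻¹ : ℝ) : ℂ)) • w) :=
      RR_apply _ _ _ _
  have i0 : ‖(inner ℂ w v : ℂ)‖ ≤ ‖v‖ := by
    refine (norm_inner_le_norm _ _).trans ?_
    nlinarith [norm_nonneg v]
  have b1 : ‖x‖ ≤ 16⁻¹ * t * (2 + 2 * 1 * 1) := by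
    rw [e, norm_smul, Complex.norm_real, Real.norm_of_nonneg (by positivity)]
    gcongr
    refine (norm_add_le _ _).trans ?_
    gcongr
    rw [norm_smul, norm_mul, Complex.norm_real, norm_neg, Real.norm_of_nonneg (by positivity)]
    gcongr
    · linarith
    · exact inv_le_one_of_one_le₀ (by linarith)
  have i1 : (inner ℂ w x : ℂ) = ((16⁻¹ * t ^ 2 : ℝ) : ℂ) * inner ℂ w v := by
    rw [e, inner_smul_right, inner_add_right, inner_smul_right, inner_self_eq_norm_sq_to_K]
    have : ((‖w‖ : ℂ)) ^ 2 = 1 - (t : ℂ) ^ 2 := by exact_mod_cast hzt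
    simp only [Complex.coe_algebraMap]
    rw [this]
    have h1 : (1 + (t : ℂ)) ≠ 0 := by
      have : (1 + t) ≠ 0 := by positivity
      exact_mod_cast this
    push_cast
    field_simp
    ring
  have i2 : ‖(inner ℂ w x : ℂ)‖ ≤ 8⁻¹ * sfun w := by
    rw [i1, norm_mul, Complex.norm_real, Real.norm_of_nonneg (by positivity), tt]
    nlinarith
  have n1 : ‖w + x‖ ^ 2 ≤ ‖w‖ ^ 2 + 5 / 16 * sfun w := by
    rw [@norm_add_sq ℂ]
    have : RCLike.re (inner ℂ w x : ℂ) ≤ ‖(inner ℂ w x : ℂ)‖ := Complex.re_le_norm _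
    have : ‖x‖ ^ 2 ≤ (16⁻¹ * t * (2 + 2 * 1 * 1)) ^ 2 := by gcongr
    have : (16⁻¹ * t * (2 + 2 * 1 * 1)) ^ 2 = 1 / 16 * sfun w := by rw [← tt]; ring
    linarith
  have n2 : ‖1 - inner ℂ w (w + x)‖ ≤ 9 / 8 * sfun w := by
    have : (1 : ℂ) - inner ℂ w (w + x) = ((sfun w : ℝ) : ℂ) - inner ℂ w x := by
      rw [inner_add_right, inner_self_eq_norm_sq_to_K, sfun]; push_cast; simp; ring
    rw [this]
    refine (norm_sub_le _ _).trans ?_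
    rw [Complex.norm_real, Real.norm_of_nonneg hs.le]
    linarith
  have s1 : 11 / 16 * sfun w ≤ sfun (w + x) := by
    have : sfun w = 1 - ‖w‖ ^ 2 := rfl
    have : sfun (w + x) = 1 - ‖w + x‖ ^ 2 := rfl
    linarith
  refine ⟨hw, ?_, ?_, ?_⟩
  · have : sfun (w + x) = 1 - ‖w + x‖ ^ 2 := rfl
    nlinarith [norm_nonneg (w + x)]
  · linarith
  · linarith

lemma submean (μ : Measure E) [μ.IsAddHaarMeasure] (p : ℝ) (hp : 1 < p) :
    ∃ K : ℝ≥0∞, K < ⊤ ∧ ∀ f : E → ℂ, DifferentiableOn ℂ f (Metric.ball 0 1) →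
      ∀ w : E, ‖w‖ < 1 → ‖f w‖ₑ ^ p ≤
        K * ENNReal.ofReal (sfun w ^ (-((Module.finrank ℂ E : ℝ) + 1))) *
          ∫⁻ u in {u | NN 2 w u}, ‖f u‖ₑ ^ p ∂μ := by
  have : FiniteDimensional ℝ E := finReal
  have : ProperSpace E := FiniteDimensional.proper ℂ E
  set d := Module.finrank ℂ E with hd
  set V := μ (Metric.ball (0 : E) 1) with hV
  have V0 : V ≠ 0 := (Metric.measure_ball_pos μ 0 one_pos).ne'
  have Vt : V ≠ ⊤ := measure_ball_lt_top.ne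
  refine ⟨V⁻¹ * ENNReal.ofReal (((16⁻¹ : ℝ) ^ (2 * d))⁻¹),
    ENNReal.mul_lt_top (ENNReal.inv_lt_top.2 (pos_iff_ne_zero.2 V0)) ENNReal.ofReal_lt_top, ?_⟩
  intro f hf w hw
  have hs := sfun_pos hw
  set t := √(sfun w) with ht
  have t0 : 0 < t := Real.sqrt_pos.2 hs
  have tt : t ^ 2 = sfun w := Real.sq_sqrt hs.le
  have hzt : ‖w‖ ^ 2 = 1 - t ^ 2 := by rw [tt, sfun]; ring
  set T := RR (16⁻¹ * t) (-(1 + t)⁻¹) w with hT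
  have hdet : LinearMap.det (T.restrictScalars ℝ) = (16⁻¹ : ℝ) ^ (2 * d) * sfun w ^ (d + 1) := by
    rw [hT, RR_det, hzt, ← tt]
    have : 1 + -(1 + t)⁻¹ * (1 - t ^ 2) = t := by
      field_simp; ring
    rw [this]; ring
  have hdet0 : LinearMap.det (T.restrictScalars ℝ) ≠ 0 := by rw [hdet]; positivity
  have hTc : Continuous T := LinearMap.continuous_of_finiteDimensional T
  have hG : DifferentiableOn ℂ (fun v => f (w + T v)) (Metric.ball 0 2) := by
    have hTd : Differentiable ℂ T := (LinearMap.toContinuousLinearMap T).differentiable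
    refine hf.comp (by fun_prop) ?_
    intro v hv
    have := (ell_NN w v hw (by simpa using hv)).2.1
    simpa using this
  have h1 := submeanp μ _ p hp hG
  simp only [map_zero, add_zero] at h1
  set H : E → ℝ≥0∞ := {u | NN 2 w u}.indicator (fun u => ‖f u‖ₑ ^ p) with hH
  have hHm : Measurable H := by
    have e : H = {u | NN 2 w u}.indicator (fun u => ‖(Metric.ball (0 : E) 1).indicator f u‖ₑ ^ p) := by
      ext u
      by_cases hu : NN 2 w u
      · have hu' : u ∈ Metric.ball (0 : E) 1 := by simpa using hu.2.1
        rw [hH, Set.indicator_of_mem (by exact hu), Set.indicator_of_mem (by exact hu),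
          Set.indicator_of_mem hu']
      · rw [hH, Set.indicator_of_notMem (by exact hu), Set.indicator_of_notMem (by exact hu)]
    rw [e]
    exact ((meas_ind f 1 hf.continuousOn).enorm.pow_const p).indicator (measSet_NN' 2 w)
  have h2 : ∫⁻ v in Metric.ball 0 1, ‖f (w + T v)‖ₑ ^ p ∂μ ≤ ∫⁻ v, H (w + T v) ∂μ := by
    rw [← lintegral_indicator Metric.isOpen_ball.measurableSet]
    apply lintegral_mono
    intro v
    by_cases hv : v ∈ Metric.ball (0 : E) 1
    · have hv' : ‖v‖ < 2 := by
        have : ‖v‖ < 1 := by simpa using hv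
        linarith
      have : w + T v ∈ {u | NN 2 w u} := ell_NN w v hw hv'
      simp only [Set.indicator_of_mem hv, hH, Set.indicator_of_mem this]
      exact le_rfl
    · simp [Set.indicator_of_notMem hv]
  have hm := Measure.map_linearMap_addHaar_eq_smul_addHaar μ hdet0
  have h3 := lintegral_map (μ := μ) (f := fun x => H (w + x))
    (g := T.restrictScalars ℝ) (hHm.comp (measurable_const_add w)) hTc.measurable
  rw [hm, lintegral_smul_measure, lintegral_add_left_eq_self, hdet] at h3
  have h4 : ∫⁻ v, H (w + T v) ∂μ = ∫⁻ v, H (w + (T.restrictScalars ℝ) v) ∂μ := rfl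
  rw [h4, ← h3, hH, lintegral_indicator (measSet_NN' 2 w)] at h2
  have h5 := h1.trans h2
  calc ‖f w‖ₑ ^ p = V⁻¹ * (‖f w‖ₑ ^ p * V) := by
        rw [mul_comm, mul_assoc, ENNReal.mul_inv_cancel V0 Vt, mul_one]
    _ ≤ V⁻¹ * _ := mul_le_mul' le_rfl h5
    _ = _ := by
      have : |((16⁻¹ : ℝ) ^ (2 * d) * sfun w ^ (d + 1))⁻¹| =
          ((16⁻¹ : ℝ) ^ (2 * d))⁻¹ * sfun w ^ (-((d : ℝ) + 1)) := by
        rw [abs_of_nonneg (by positivity), mul_inv, ← Nat.cast_succ, Real.rpow_neg hs.le,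
          Real.rpow_natCast]
      rw [this, ENNReal.ofReal_mul (by positivity), smul_eq_mul]
      ring

end Gen3
lemma rpow_comp {A x y θ : ℝ} (hA : 0 < A) (hx : 0 < x) (hy : 0 < y) (h1 : x ≤ A * y)
    (h2 : y ≤ A * x) : x ^ θ ≤ A ^ |θ| * y ^ θ := by
  rcases le_total 0 θ with h | h
  · rw [abs_of_nonneg h, ← Real.mul_rpow hA.le hy.le]
    exact Real.rpow_le_rpow hx.le h1 h
  · have h3 : y ^ (-θ) ≤ A ^ (-θ) * x ^ (-θ) := by
      rw [← Real.mul_rpow hA.le hx.le]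
      exact Real.rpow_le_rpow hy.le h2 (by linarith)
    rw [abs_of_nonpos h]
    rw [Real.rpow_neg hx.le, Real.rpow_neg hy.le] at h3
    have hx' : 0 < x ^ θ := Real.rpow_pos_of_pos hx θ
    have hy' : 0 < y ^ θ := Real.rpow_pos_of_pos hy θ
    rw [inv_le_iff_one_le_mul₀ hy'] at h3
    have : 1 * x ^ θ ≤ A ^ (-θ) * (x ^ θ)⁻¹ * y ^ θ * x ^ θ := by gcongr
    calc x ^ θ = 1 * x ^ θ := (one_mul _).symm
      _ ≤ _ := this
      _ = A ^ (-θ) * y ^ θ := by field_simp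

section Gen4

variable {E : Type*} [NormedAddCommGroup E] [InnerProductSpace ℂ E]

lemma NN.rpow_le {C : ℝ} (hC : 0 < C) {z w : E} (h : NN C z w) (θ : ℝ) :
    ENNReal.ofReal (sfun w ^ θ) ≤ ENNReal.ofReal ((2 * C) ^ |θ|) * ENNReal.ofReal (sfun z ^ θ) := by
  rw [← ENNReal.ofReal_mul (by positivity)]
  exact ENNReal.ofReal_le_ofReal
    (rpow_comp (by positivity) (sfun_pos h.2.1) (sfun_pos h.1) h.sfun_le h.symm.sfun_le)

variable [FiniteDimensional ℂ E] [MeasurableSpace E] [BorelSpace E]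

lemma wt_NN (μ : Measure E) [μ.IsAddHaarMeasure] (C : ℝ) (hC : 0 < C) (θ : ℝ) :
    ∃ K : ℝ≥0∞, K < ⊤ ∧ ∀ z : E, ‖z‖ < 1 →
      ∫⁻ w in {w | NN C z w}, ENNReal.ofReal (sfun w ^ θ) ∂μ ≤
        K * ENNReal.ofReal (sfun z ^ (θ + ((Module.finrank ℂ E : ℝ) + 1))) := by
  obtain ⟨K, hK, h⟩ := vol_NN μ C hC.le
  refine ⟨ENNReal.ofReal ((2 * C) ^ |θ|) * K, ENNReal.mul_lt_top ENNReal.ofReal_lt_top hK, ?_⟩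
  intro z hz
  have hs := sfun_pos hz
  calc ∫⁻ w in {w | NN C z w}, ENNReal.ofReal (sfun w ^ θ) ∂μ
      ≤ ∫⁻ w in {w | NN C z w},
          ENNReal.ofReal ((2 * C) ^ |θ|) * ENNReal.ofReal (sfun z ^ θ) ∂μ :=
        setLIntegral_mono' (measSet_NN' C z) (fun w hw => NN.rpow_le hC hw θ)
    _ = ENNReal.ofReal ((2 * C) ^ |θ|) * ENNReal.ofReal (sfun z ^ θ) * μ {w | NN C z w} := by
        rw [setLIntegral_const]
    _ ≤ ENNReal.ofReal ((2 * C) ^ |θ|) * ENNReal.ofReal (sfun z ^ θ) *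
        (K * ENNReal.ofReal (sfun z ^ ((Module.finrank ℂ E : ℝ) + 1))) :=
        mul_le_mul' le_rfl (h z hz)
    _ = _ := by
        rw [Real.rpow_add hs θ, ENNReal.ofReal_mul (by positivity)]; ring

lemma meas_sfun (θ : ℝ) : Measurable (fun z : E => ENNReal.ofReal (sfun z ^ θ)) := by
  unfold sfun
  exact ((measurable_const.sub (measurable_norm.pow_const 2)).pow_const θ).ennreal_ofReal

lemma fub_NN (μ : Measure E) [μ.IsAddHaarMeasure] (C : ℝ) (hC : 0 < C) (θ : ℝ) :
    ∃ K : ℝ≥0∞, K < ⊤ ∧ ∀ F : E → ℝ≥0∞, Measurable F →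
      ∫⁻ z in Metric.ball 0 1, ENNReal.ofReal (sfun z ^ θ) * ∫⁻ u in {u | NN C z u}, F u ∂μ ∂μ ≤
        K * ∫⁻ u in Metric.ball 0 1,
          ENNReal.ofReal (sfun u ^ (θ + ((Module.finrank ℂ E : ℝ) + 1))) * F u ∂μ := by
  have : ProperSpace E := FiniteDimensional.proper ℂ E
  have : SecondCountableTopology E := secCount
  obtain ⟨K, hK, h⟩ := wt_NN μ C hC θ
  refine ⟨K, hK, ?_⟩
  intro F hF
  set k : E × E → ℝ≥0∞ := {x : E × E | NN C x.1 x.2}.indicator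
    (fun x => ENNReal.ofReal (sfun x.1 ^ θ) * F x.2) with hk
  have hkm : Measurable k :=
    (((meas_sfun θ).comp measurable_fst).mul (hF.comp measurable_snd)).indicator (measSet_NN C)
  have hB : MeasurableSet (Metric.ball (0 : E) 1) := Metric.isOpen_ball.measurableSet
  calc _ ≤ ∫⁻ z, ENNReal.ofReal (sfun z ^ θ) * ∫⁻ u in {u | NN C z u}, F u ∂μ ∂μ :=
        setLIntegral_le_lintegral _ _
    _ = ∫⁻ z, ∫⁻ u, k (z, u) ∂μ ∂μ := by
        congr 1; ext z
        rw [← lintegral_const_mul _ hF, ← lintegral_indicator (measSet_NN' C z)]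
        rfl
    _ = ∫⁻ u, ∫⁻ z, k (z, u) ∂μ ∂μ := lintegral_lintegral_swap hkm.aemeasurable
    _ ≤ ∫⁻ u, (Metric.ball (0 : E) 1).indicator (fun u => K * (
          ENNReal.ofReal (sfun u ^ (θ + ((Module.finrank ℂ E : ℝ) + 1))) * F u)) u ∂μ := by
        apply lintegral_mono
        intro u
        have e : ∫⁻ z, k (z, u) ∂μ = ∫⁻ z in {z | NN C u z}, ENNReal.ofReal (sfun z ^ θ) * F u ∂μ := by
          rw [← lintegral_indicator (measSet_NN' C u)]
          congr 1; ext z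
          simp only [hk, Set.indicator, Set.mem_setOf_eq]
          have : NN C z u ↔ NN C u z := ⟨NN.symm, NN.symm⟩
          simp only [this]
        by_cases hu : u ∈ Metric.ball (0 : E) 1
        · simp only [Set.indicator_of_mem hu]
          rw [e, lintegral_mul_const _ (meas_sfun θ), ← mul_assoc]
          exact mul_le_mul' (h u (by simpa using hu)) le_rfl
        · have : {z | NN C u z} = ∅ := by
            ext z
            simp only [Set.mem_setOf_eq, Set.mem_empty_iff_false, iff_false]
            intro hn
            exact hu (by simpa using hn.1)
          simp only
          rw [e, this]; simp
    _ = _ := by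
        rw [lintegral_indicator hB, lintegral_const_mul]
        exact (meas_sfun _).mul hF

end Gen4

lemma herm_eq {n : ℕ} (z w : En n) : herm z w = inner ℂ w z := by
  simp [herm, PiLp.inner_apply]

lemma mobius_norm {n : ℕ} (z w : En n) (hz : ‖z‖ < 1) (hw : ‖w‖ < 1) :
    (1 - ‖mobius z w‖ ^ 2) * ‖1 - inner ℂ z w‖ ^ 2 = sfun z * sfun w := by
  have h0 : 0 < ‖1 - inner ℂ z w‖ := by
    have := sfun_le hz hw
    have := sfun_pos hw
    linarith
  have hsz := sfun_pos hz
  have hne : (1 : ℂ) - inner ℂ z w ≠ 0 := norm_pos_iff.1 h0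
  set x := z - prj z w - ((Real.sqrt (1 - ‖z‖ ^ 2) : ℝ) : ℂ) • (w - prj z w) with hx
  have e : ‖mobius z w‖ ^ 2 * ‖1 - inner ℂ z w‖ ^ 2 = ‖x‖ ^ 2 := by
    rw [mobius, ← hx, herm_eq, norm_smul, norm_div, norm_one]
    field_simp
  rw [sub_mul, e, one_mul]
  have nI : ‖1 - inner ℂ z w‖ ^ 2 = 1 - 2 * (inner ℂ z w : ℂ).re + ‖(inner ℂ z w : ℂ)‖ ^ 2 := by
    rw [← Complex.normSq_eq_norm_sq, ← Complex.normSq_eq_norm_sq, Complex.normSq_apply,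
      Complex.normSq_apply]
    simp; ring
  rw [nI]
  by_cases hz0 : z = 0
  · subst hz0
    simp [hx, prj, sfun]
  have hzn : 0 < ‖z‖ := norm_pos_iff.2 hz0
  set I : ℂ := inner ℂ z w with hI
  set y := w - prj z w with hy
  have hp : prj z w = (I / (‖z‖ : ℂ) ^ 2) • z := by
    rw [prj, if_neg hz0, herm_eq, herm_eq, inner_self_eq_norm_sq_to_K]; rfl
  have hzc : (‖z‖ : ℂ) ≠ 0 := by exact_mod_cast hzn.ne'
  have ho : (inner ℂ z y : ℂ) = 0 := by
    rw [hy, hp, inner_sub_right, inner_smul_right, inner_self_eq_norm_sq_to_K, ← hI]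
    simp only [Complex.coe_algebraMap]
    field_simp
    ring
  have n1 : ‖x‖ ^ 2 = ‖1 - I / (‖z‖ : ℂ) ^ 2‖ ^ 2 * ‖z‖ ^ 2 + sfun z * ‖y‖ ^ 2 := by
    have : x = (1 - I / (‖z‖ : ℂ) ^ 2) • z - ((Real.sqrt (sfun z) : ℝ) : ℂ) • y := by
      rw [hx, hp, sub_smul, one_smul]; rfl
    rw [this, @norm_sub_sq ℂ, inner_smul_left, inner_smul_right, ho, norm_smul, norm_smul,
      mul_pow, mul_pow, Complex.norm_real, Real.norm_of_nonneg (Real.sqrt_nonneg _),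
      Real.sq_sqrt hsz.le]
    simp
  have n2 : ‖w‖ ^ 2 = ‖I‖ ^ 2 / ‖z‖ ^ 2 + ‖y‖ ^ 2 := by
    have : w = (I / (‖z‖ : ℂ) ^ 2) • z + y := by rw [hy, hp]; abel
    rw [this, @norm_add_sq ℂ, inner_smul_left, ho, norm_smul, norm_div, norm_pow, Complex.norm_real,
      norm_norm]
    simp
    field_simp
  have n3 : ‖1 - I / (‖z‖ : ℂ) ^ 2‖ ^ 2 = 1 - 2 * I.re / ‖z‖ ^ 2 + ‖I‖ ^ 2 / ‖z‖ ^ 4 := by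
    have : I / (‖z‖ : ℂ) ^ 2 = (((‖z‖ ^ 2)⁻¹ : ℝ) : ℂ) * I := by push_cast; field_simp
    rw [this, ← Complex.normSq_eq_norm_sq, ← Complex.normSq_eq_norm_sq, Complex.normSq_apply,
      Complex.normSq_apply]
    simp only [Complex.sub_re, Complex.one_re, Complex.re_ofReal_mul, Complex.sub_im,
      Complex.one_im, Complex.im_ofReal_mul]
    field_simp
    ring
  have y2 : ‖y‖ ^ 2 = ‖w‖ ^ 2 - ‖I‖ ^ 2 / ‖z‖ ^ 2 := by rw [n2]; ring
  rw [n1, n3, y2]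
  unfold sfun
  field_simp
  ring

lemma Dball_NN {n : ℕ} (γ : ℝ) (z : En n) (hz : ‖z‖ < 1) :
    Dball z γ ⊆ {w | NN (2 * Real.exp (2 * γ)) z w} := by
  rintro w ⟨hw, hb⟩
  have hw' : ‖w‖ < 1 := by simpa [uball] using hw
  have hm := mobius_norm z w hz hw'
  have hsz := sfun_pos hz
  have hsw := sfun_pos hw'
  have h1 := sfun_le hz hw'
  have h2 := sfun_le hw' hz
  rw [norm_one_sub_inner_symm] at h2
  set a := ‖1 - inner ℂ z w‖ with ha
  have ha0 : 0 < a := by linarith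
  set r := ‖mobius z w‖ with hr
  have hr0 : 0 ≤ r := norm_nonneg _
  have hr1 : r < 1 := by
    by_contra hcon
    push Not at hcon
    have : 0 < sfun z * sfun w := by positivity
    have : (1 - r ^ 2) * a ^ 2 ≤ 0 := mul_nonpos_of_nonpos_of_nonneg (by nlinarith) (by positivity)
    linarith
  have hlog : Real.log ((1 + r) / (1 - r)) < 2 * γ := by
    unfold bmet at hb; linarith
  have hpos : 0 < (1 + r) / (1 - r) := div_pos (by linarith) (by linarith)
  rw [Real.log_lt_iff_lt_exp hpos, div_lt_iff₀ (by linarith)] at hlog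
  set M := Real.exp (2 * γ) with hM
  have hM0 : 0 < M := Real.exp_pos _
  have h3 : 1 ≤ M * (1 - r ^ 2) := by nlinarith [mul_nonneg hM0.le hr0, mul_nonneg (mul_nonneg hM0.le hr0) (by linarith : 0 ≤ 1 - r)]
  have h4 : a ^ 2 ≤ M * (sfun z * sfun w) := by
    rw [← hm]; nlinarith [sq_nonneg a]
  refine ⟨hz, hw', ?_, ?_⟩
  · have : a * a ≤ a * (2 * M * sfun z) := by
      have : M * (sfun z * sfun w) ≤ M * (sfun z * (2 * a)) := by gcongr
      nlinarith
    exact le_of_mul_le_mul_left this ha0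
  · have : a * a ≤ a * (2 * M * sfun w) := by
      have : M * (sfun z * sfun w) ≤ M * ((2 * a) * sfun w) := by gcongr
      nlinarith
    exact le_of_mul_le_mul_left this ha0
lemma area_le (n : ℕ) (γ q p : ℝ) (hq : 1 < q) (hp : 1 < p) :
    ∃ C₁ : ℝ, 0 < C₁ ∧ ∃ L : ℝ≥0∞, L < ⊤ ∧ ∀ f : En n → ℂ, DifferentiableOn ℂ f (uball n) →
      ∀ z : En n, ‖z‖ < 1 → (areaF γ q (fun w => ‖f w‖) z) ^ p ≤
        L * (ENNReal.ofReal (sfun z ^ (-((n : ℝ) + 1))) *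
          ∫⁻ u in {u | NN C₁ z u}, ‖(uball n).indicator f u‖ₑ ^ p ∂vol n) := by
  have hmu : (vol n).IsAddHaarMeasure := by unfold vol; infer_instance
  have hfr : Module.finrank ℂ (En n) = n := by simp
  set C₀ : ℝ := 2 * Real.exp (2 * γ) with hC₀
  have hC₀p : 0 < C₀ := by positivity
  obtain ⟨K₁, hK₁, h₁⟩ := submean (vol n) p hp
  obtain ⟨K₂, hK₂, h₂⟩ := wt_NN (vol n) C₀ hC₀p (-((n : ℝ) + 1))
  rw [hfr] at h₁ h₂
  have p0 : 0 < p := by linarith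
  have q0 : 0 < q := by linarith
  refine ⟨4 * C₀ + 4 * 2 + 4 * C₀ * 2, by positivity,
    K₁ * ENNReal.ofReal ((2 * C₀) ^ |(-((n : ℝ) + 1))|) * K₂ ^ (p / q), ?_, ?_⟩
  · refine ENNReal.mul_lt_top (ENNReal.mul_lt_top hK₁ ENNReal.ofReal_lt_top) ?_
    exact ENNReal.rpow_lt_top_of_nonneg (by positivity) hK₂.ne
  intro f hf z hz
  set θ : ℝ := -((n : ℝ) + 1) with hθ
  set M := ∫⁻ u in {u | NN (4 * C₀ + 4 * 2 + 4 * C₀ * 2) z u}, ‖(uball n).indicator f u‖ₑ ^ p ∂vol n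
    with hM
  set B := K₁ * ENNReal.ofReal ((2 * C₀) ^ |θ|) * (ENNReal.ofReal (sfun z ^ θ) * M) with hB
  have hpt : ∀ w, NN C₀ z w → ‖f w‖ₑ ^ p ≤ B := by
    intro w hw
    calc ‖f w‖ₑ ^ p ≤ K₁ * ENNReal.ofReal (sfun w ^ θ) * ∫⁻ u in {u | NN 2 w u}, ‖f u‖ₑ ^ p ∂vol n :=
          h₁ f hf w hw.2.1
      _ ≤ K₁ * (ENNReal.ofReal ((2 * C₀) ^ |θ|) * ENNReal.ofReal (sfun z ^ θ)) * M := by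
          refine mul_le_mul' (mul_le_mul' le_rfl (hw.rpow_le hC₀p θ)) ?_
          calc ∫⁻ u in {u | NN 2 w u}, ‖f u‖ₑ ^ p ∂vol n
              = ∫⁻ u in {u | NN 2 w u}, ‖(uball n).indicator f u‖ₑ ^ p ∂vol n := by
                apply setLIntegral_congr_fun (measSet_NN' 2 w)
                intro u hu
                have : u ∈ uball n := by simpa [uball] using hu.2.1
                simp only [Set.indicator_of_mem this]
            _ ≤ M := lintegral_mono_set (fun u hu => NN.comp hC₀p.le (by norm_num) hw hu)
      _ = B := by rw [hB]; ring
  have htau : measTau n {w | NN C₀ z w} ≤ K₂ := by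
    rw [measTau, withDensity_apply _ (measSet_NN' C₀ z)]
    refine (lintegral_mono' (Measure.restrict_mono le_rfl Measure.restrict_le_self) le_rfl).trans ?_
    refine (h₂ z hz).trans (le_of_eq ?_)
    simp [hθ]
  have harea : areaF γ q (fun w => ‖f w‖) z ≤ (B ^ (q / p) * K₂) ^ (1 / q) := by
    unfold areaF
    apply ENNReal.rpow_le_rpow _ (by positivity)
    calc _ ≤ ∫⁻ w in {w | NN C₀ z w}, ENNReal.ofReal ‖f w‖ ^ q ∂measTau n :=
          lintegral_mono_set (Dball_NN γ z hz)
      _ ≤ ∫⁻ w in {w | NN C₀ z w}, B ^ (q / p) ∂measTau n := by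
          apply setLIntegral_mono' (measSet_NN' C₀ z)
          intro w hw
          have := ENNReal.rpow_le_rpow (hpt w hw) (by positivity : 0 ≤ q / p)
          rw [← ENNReal.rpow_mul, mul_div_cancel₀ _ p0.ne'] at this
          rwa [ofReal_norm]
      _ = B ^ (q / p) * measTau n {w | NN C₀ z w} := setLIntegral_const _ _
      _ ≤ _ := mul_le_mul' le_rfl htau
  calc _ ≤ ((B ^ (q / p) * K₂) ^ (1 / q)) ^ p := ENNReal.rpow_le_rpow harea p0.le
    _ = B * K₂ ^ (p / q) := by
        rw [← ENNReal.rpow_mul, ENNReal.mul_rpow_of_nonneg _ _ (by positivity), ← ENNReal.rpow_mul]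
        have e1 : q / p * (1 / q * p) = 1 := by field_simp
        have e2 : 1 / q * p = p / q := by ring
        rw [e1, e2, ENNReal.rpow_one]
    _ = _ := by rw [hB]; ring

/-- `L^p`-boundedness of the area integral operator on Bergman spaces:
`‖A_γ^{(q)} f‖_{L^p(dv_α)} ≤ C ‖f‖_{p,α}` for every `f ∈ A^p_α`. -/
theorem stmt15 (n : ℕ) (hn : 1 ≤ n) (γ α q p : ℝ) (hγ : 0 < γ) (hα : -1 < α)
    (hq : 1 < q) (hp : 1 < p) :
    ∃ C : ℝ≥0∞, 0 < C ∧ C < ⊤ ∧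
      ∀ f : En n → ℂ, DifferentiableOn ℂ f (uball n) → apnorm n p α f < ⊤ →
        (∫⁻ z, (areaF γ q (fun w => ‖f w‖) z) ^ p ∂measA n α) ^ (1 / p) ≤
          C * apnorm n p α f := by
  have hmu : (vol n).IsAddHaarMeasure := by unfold vol; infer_instance
  have hfr : Module.finrank ℂ (En n) = n := by simp
  obtain ⟨C₁, hC₁, L, hL, hA⟩ := area_le n γ q p hq hp
  obtain ⟨K₃, hK₃, h₃⟩ := fub_NN (vol n) C₁ hC₁ (α + -((n : ℝ) + 1))
  rw [hfr] at h₃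
  have p0 : 0 < p := by linarith
  refine ⟨(L * K₃ + 1) ^ (1 / p), ENNReal.rpow_pos (by simp) ?_,
    ENNReal.rpow_lt_top_of_nonneg (by positivity) ?_, ?_⟩
  · exact ENNReal.add_ne_top.2 ⟨(ENNReal.mul_lt_top hL hK₃).ne, ENNReal.one_ne_top⟩
  · exact ENNReal.add_ne_top.2 ⟨(ENNReal.mul_lt_top hL hK₃).ne, ENNReal.one_ne_top⟩
  intro f hf _
  unfold apnorm
  rw [← ENNReal.mul_rpow_of_nonneg _ _ (by positivity)]
  apply ENNReal.rpow_le_rpow _ (by positivity)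
  set F : En n → ℝ≥0∞ := fun u => ‖(uball n).indicator f u‖ₑ ^ p with hF
  have hFm : Measurable F := (meas_ind f 1 hf.continuousOn).enorm.pow_const p
  have hBm : MeasurableSet (uball n) := Metric.isOpen_ball.measurableSet
  set c := ENNReal.ofReal (cnorm n α) with hc
  have hdens : ∀ z ∈ uball n, ENNReal.ofReal (cnorm n α * (1 - ‖z‖ ^ 2) ^ α) =
      c * ENNReal.ofReal (sfun z ^ α) := by
    intro z hz
    have hz' : ‖z‖ < 1 := by simpa [uball] using hz
    have := sfun_pos hz'
    rw [ENNReal.ofReal_mul' (Real.rpow_nonneg (by unfold sfun at this; exact this.le) _)]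
    rfl
  have hdm : Measurable (fun z : En n => ENNReal.ofReal (cnorm n α * (1 - ‖z‖ ^ 2) ^ α)) :=
    (((measurable_const.sub (measurable_norm.pow_const 2)).pow_const α).const_mul _).ennreal_ofReal
  have hR : ∫⁻ z, ENNReal.ofReal (‖f z‖ ^ p) ∂measA n α =
      c * ∫⁻ u in uball n, ENNReal.ofReal (sfun u ^ α) * F u ∂vol n := by
    rw [measA, lintegral_withDensity_eq_lintegral_mul_non_measurable₀ _ hdm.aemeasurable
      (Filter.Eventually.of_forall fun _ => ENNReal.ofReal_lt_top),
      ← lintegral_const_mul' _ _ ENNReal.ofReal_ne_top]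
    apply setLIntegral_congr_fun hBm
    intro z hz
    simp only [Pi.mul_apply]
    rw [hdens z hz, hF, mul_assoc]
    simp only [Set.indicator_of_mem hz]
    rw [← ENNReal.ofReal_rpow_of_nonneg (norm_nonneg _) p0.le, ofReal_norm]
  rw [hR]
  calc ∫⁻ z, (areaF γ q (fun w => ‖f w‖) z) ^ p ∂measA n α
      ≤ ∫⁻ z in uball n, ENNReal.ofReal (cnorm n α * (1 - ‖z‖ ^ 2) ^ α) *
          (areaF γ q (fun w => ‖f w‖) z) ^ p ∂vol n :=
        lintegral_withDensity_le_lintegral_mul _ hdm _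
    _ ≤ ∫⁻ z in uball n, c * L * (ENNReal.ofReal (sfun z ^ (α + -((n : ℝ) + 1))) *
          ∫⁻ u in {u | NN C₁ z u}, F u ∂vol n) ∂vol n := by
        apply setLIntegral_mono' hBm
        intro z hz
        have hz' : ‖z‖ < 1 := by simpa [uball] using hz
        have hs := sfun_pos hz'
        rw [hdens z hz]
        refine (mul_le_mul' le_rfl (hA f hf z hz')).trans (le_of_eq ?_)
        rw [Real.rpow_add hs α, ENNReal.ofReal_mul (by positivity)]
        ring
    _ = c * L * ∫⁻ z in uball n, (ENNReal.ofReal (sfun z ^ (α + -((n : ℝ) + 1))) *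
          ∫⁻ u in {u | NN C₁ z u}, F u ∂vol n) ∂vol n := by
        apply lintegral_const_mul'
        exact (ENNReal.mul_lt_top ENNReal.ofReal_lt_top hL).ne
    _ ≤ c * L * (K₃ * ∫⁻ u in uball n,
          ENNReal.ofReal (sfun u ^ (α + -((n : ℝ) + 1) + ((n : ℝ) + 1))) * F u ∂vol n) :=
        mul_le_mul' le_rfl (h₃ F hFm)
    _ = (L * K₃) * (c * ∫⁻ u in uball n, ENNReal.ofReal (sfun u ^ α) * F u ∂vol n) := by
        rw [neg_add_cancel_right]; ring
    _ ≤ _ := mul_le_mul' le_self_add le_rfl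
end
end

section
/- For each γ > 0 there exists a constant C > 0 such that ϱ(φ_u(w), φ_ζ(w)) ≤ C |1−⟨u,ζ⟩| for all u, ζ ∈ 𝔹_n and all w ∈ D(0,γ). -/
open MeasureTheory Filter Topology
open scoped Classical ENNReal

noncomputable section

lemma herm_norm_le {n : ℕ} (z w : En n) : ‖herm z w‖ ≤ ‖z‖ * ‖w‖ := by
  rw [herm_eq, mul_comm]; exact norm_inner_le_norm w z

lemma herm_self {n : ℕ} (z : En n) : herm z z = ((‖z‖ ^ 2 : ℝ) : ℂ) := by
  rw [herm_eq, inner_self_eq_norm_sq_to_K]; simp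

lemma prj_norm_le {n : ℕ} (z w : En n) : ‖prj z w‖ ≤ ‖w‖ := by
  unfold prj
  split_ifs with h
  · simp
  · have hz : 0 < ‖z‖ := norm_pos_iff.mpr h
    rw [norm_smul, norm_div, herm_self, Complex.norm_real, Real.norm_of_nonneg (by positivity),
      div_mul_eq_mul_div, div_le_iff₀ (by positivity)]
    nlinarith [herm_norm_le w z]

lemma den_ge {n : ℕ} {m : ℝ} (u w : En n) (hu : ‖u‖ < 1) (hw : ‖w‖ ≤ 1 - m) :
    m ≤ ‖1 - herm w u‖ := by
  have h1 := herm_norm_le w u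
  have h2 : ‖(1:ℂ)‖ - ‖herm w u‖ ≤ ‖1 - herm w u‖ := norm_sub_norm_le _ _
  rw [norm_one] at h2
  nlinarith [norm_nonneg w, norm_nonneg u]

lemma inv_den_le {n : ℕ} {m : ℝ} (hm : 0 < m) (u w : En n) (hu : ‖u‖ < 1) (hw : ‖w‖ ≤ 1 - m) :
    ‖(1:ℂ) / (1 - herm w u)‖ ≤ 1 / m := by
  rw [norm_div, norm_one]
  exact one_div_le_one_div_of_le hm (den_ge u w hu hw)

lemma mob_bound {n : ℕ} {m : ℝ} (hm : 0 < m) (u w : En n) (hu : ‖u‖ < 1) (hw : ‖w‖ ≤ 1 - m) :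
    ‖mobius u w‖ ≤ 4 / m := by
  unfold mobius
  rw [norm_smul]
  have h1 := inv_den_le hm u w hu hw
  have hp := prj_norm_le u w
  have hs : ‖((Real.sqrt (1 - ‖u‖ ^ 2) : ℝ) : ℂ)‖ ≤ 1 := by
    rw [Complex.norm_real, Real.norm_of_nonneg (Real.sqrt_nonneg _)]
    refine Real.sqrt_le_iff.mpr ⟨zero_le_one, ?_⟩
    nlinarith [norm_nonneg u]
  have h2 : ‖u - prj u w - ((Real.sqrt (1 - ‖u‖ ^ 2) : ℝ) : ℂ) • (w - prj u w)‖ ≤ 4 := by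
    refine (norm_sub_le _ _).trans ?_
    rw [norm_smul]
    have a1 := norm_sub_le u (prj u w)
    have a2 := norm_sub_le w (prj u w)
    have a3 := mul_le_mul hs a2 (norm_nonneg _) zero_le_one
    linarith
  calc _ ≤ (1/m) * 4 := mul_le_mul h1 h2 (norm_nonneg _) (by positivity)
    _ = 4/m := by ring

/-- decomposition -/
lemma mob_decomp {n : ℕ} {m e : ℝ} (hm : 0 < m) (u w : En n) (hu : ‖u‖ < 1)
    (hw : ‖w‖ ≤ 1 - m) (hu2 : 1/2 ≤ ‖u‖) (he : 1 - ‖u‖ ^ 2 ≤ e) :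
    ∃ (c : ℂ) (p : En n), mobius u w = c • u - p ∧ herm p u = 0 ∧ ‖1 - c‖ ≤ 4 / m * e ∧
      ‖p‖ ≤ 4 / m * Real.sqrt e := by
  have hu0 : u ≠ 0 := by
    rintro rfl; norm_num at hu2
  have hd := den_ge u w hu hw
  have hd0 : 1 - herm w u ≠ 0 := by
    intro h; rw [h, norm_zero] at hd; linarith
  have hinv := inv_den_le hm u w hu hw
  have hpr := prj_norm_le u w
  have hN : ((‖u‖ ^ 2 : ℝ) : ℂ) ≠ 0 := by
    exact_mod_cast (by positivity : (‖u‖^2:ℝ) ≠ 0)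
  have he0 : 0 ≤ e := by nlinarith [norm_nonneg u]
  refine ⟨(1 - herm w u / herm u u) / (1 - herm w u),
    ((1:ℂ) / (1 - herm w u)) • (((Real.sqrt (1 - ‖u‖ ^ 2) : ℝ) : ℂ) • (w - prj u w)), ?_, ?_, ?_, ?_⟩
  · unfold mobius
    rw [smul_sub]
    congr 1
    simp only [prj, if_neg hu0]
    module
  · have : inner ℂ u (w - prj u w) = 0 := by
      simp only [prj, if_neg hu0, inner_sub_right, inner_smul_right, ← herm_eq, herm_self]
      field_simp; simp
    rw [herm_eq, inner_smul_right, inner_smul_right, this]; simp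
  · have : 1 - (1 - herm w u / herm u u) / (1 - herm w u)
        = ((1:ℂ) / (1 - herm w u)) * ((1 - ((‖u‖ ^ 2 : ℝ) : ℂ)) * (herm w u / ((‖u‖ ^ 2 : ℝ) : ℂ))) := by
      rw [herm_self]; field_simp; ring
    rw [this, norm_mul, norm_mul]
    have k1 : ‖1 - ((‖u‖ ^ 2 : ℝ) : ℂ)‖ ≤ e := by
      rw [← Complex.ofReal_one, ← Complex.ofReal_sub, Complex.norm_real, Real.norm_of_nonneg]
      · exact he
      · nlinarith [norm_nonneg u]
    have k2 : ‖herm w u / ((‖u‖ ^ 2 : ℝ) : ℂ)‖ ≤ 4 := by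
      rw [norm_div, Complex.norm_real, Real.norm_of_nonneg (by positivity), div_le_iff₀ (by positivity)]
      have := herm_norm_le w u
      nlinarith [norm_nonneg w, norm_nonneg u]
    calc _ ≤ (1/m) * (e * 4) := by gcongr
      _ = 4 / m * e := by ring
  · rw [norm_smul, norm_smul]
    have k1 : ‖((Real.sqrt (1 - ‖u‖ ^ 2) : ℝ) : ℂ)‖ ≤ Real.sqrt e := by
      rw [Complex.norm_real, Real.norm_of_nonneg (Real.sqrt_nonneg _)]
      exact Real.sqrt_le_sqrt he
    have k2 : ‖w - prj u w‖ ≤ 4 := by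
      have := norm_sub_le w (prj u w); linarith
    calc _ ≤ (1/m) * (Real.sqrt e * 4) := by gcongr
      _ = 4 / m * Real.sqrt e := by ring

lemma key {n : ℕ} {K e : ℝ} (hK : 0 < K) (he : 0 ≤ e) (he1 : e ≤ 1) (u v p q : En n) (c d : ℂ)
    (hu : ‖u‖ < 1) (hv : ‖v‖ < 1)
    (hp : herm p u = 0) (hq : herm q v = 0) (hc : ‖1 - c‖ ≤ K * e) (hd : ‖1 - d‖ ≤ K * e)
    (hpn : ‖p‖ ≤ K * Real.sqrt e) (hqn : ‖q‖ ≤ K * Real.sqrt e)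
    (huv : ‖1 - herm u v‖ ≤ e) :
    ‖1 - herm (c • u - p) (d • v - q)‖ ≤ (10 * (1 + K) ^ 2) * e := by
  set r := Real.sqrt e with hr
  have hrr : r * r = e := Real.mul_self_sqrt he
  have hr0 : 0 ≤ r := Real.sqrt_nonneg _
  have hc1 : ‖c‖ ≤ 1 + K := by
    have : ‖c‖ ≤ ‖(1:ℂ)‖ + ‖1 - c‖ := by
      have := norm_sub_le (1:ℂ) (1 - c); simpa using this
    rw [norm_one] at this; nlinarith
  have hd1 : ‖d‖ ≤ 1 + K := by
    have : ‖d‖ ≤ ‖(1:ℂ)‖ + ‖1 - d‖ := by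
      have := norm_sub_le (1:ℂ) (1 - d); simpa using this
    rw [norm_one] at this; nlinarith
  have huv2 : ‖u - v‖ ≤ 2 * r := by
    have h1 : ‖u - v‖ ^ 2 = ‖u‖ ^ 2 - 2 * (herm u v).re + ‖v‖ ^ 2 := by
      rw [norm_sub_sq (𝕜 := ℂ) u v, herm_eq, ← inner_conj_symm u v, RCLike.conj_re]; rfl
    have h2 : 1 - (herm u v).re ≤ e := by
      have := Complex.re_le_norm (1 - herm u v)
      simp at this; linarith
    have : ‖u - v‖ ^ 2 ≤ (2 * r) ^ 2 := by nlinarith [norm_nonneg u, norm_nonneg v]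
    exact le_of_sq_le_sq this (by positivity)
  have e1 : ‖herm p v‖ ≤ 2 * K * e := by
    have : herm p v = - herm p (u - v) := by
      rw [herm_eq] at *; rw [herm_eq, inner_sub_left, hp]; simp
    rw [this, norm_neg]
    refine (herm_norm_le _ _).trans ?_
    calc _ ≤ (K * r) * (2 * r) := by gcongr
      _ = _ := by rw [← hrr]; ring
  have e2 : ‖herm u q‖ ≤ 2 * K * e := by
    have hq' : inner ℂ q v = 0 := by
      rw [← inner_conj_symm, ← herm_eq, hq]; simp
    have : herm u q = herm (u - v) q := by
      rw [herm_eq, herm_eq, inner_sub_right, hq']; simp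
    rw [this]
    refine (herm_norm_le _ _).trans ?_
    calc _ ≤ (2 * r) * (K * r) := by gcongr
      _ = _ := by rw [← hrr]; ring
  have e3 : ‖herm p q‖ ≤ K ^ 2 * e := by
    refine (herm_norm_le _ _).trans ?_
    calc _ ≤ (K * r) * (K * r) := by gcongr
      _ = _ := by rw [← hrr]; ring
  have hid : 1 - herm (c • u - p) (d • v - q) =
      (1 - c) + c * (starRingEnd ℂ) (1 - d) + c * (starRingEnd ℂ d) * (1 - herm u v)
       + c * herm u q + (starRingEnd ℂ d) * herm p v - herm p q := by
    simp only [herm_eq, inner_sub_left, inner_sub_right, inner_smul_left, inner_smul_right, map_sub, map_one]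
    ring
  rw [hid]
  refine (norm_sub_le _ _).trans ?_
  have t1 := norm_add₃_le (a := (1 - c)) (b := c * (starRingEnd ℂ) (1 - d)) (c := c * (starRingEnd ℂ d) * (1 - herm u v))
  have t2 := norm_add₃_le (a := (1 - c) + c * (starRingEnd ℂ) (1 - d) + c * (starRingEnd ℂ d) * (1 - herm u v))
    (b := c * herm u q) (c := (starRingEnd ℂ d) * herm p v)
  simp only [norm_mul, RCLike.norm_conj] at t1 t2
  have s1 : ‖c‖ * ‖1 - d‖ ≤ (1 + K) * (K * e) := by gcongr
  have s2 : ‖c‖ * ‖d‖ * ‖1 - herm u v‖ ≤ (1 + K) * (1 + K) * e := by gcongr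
  have s3 : ‖c‖ * ‖herm u q‖ ≤ (1 + K) * (2 * K * e) := by gcongr
  have s4 : ‖d‖ * ‖herm p v‖ ≤ (1 + K) * (2 * K * e) := by gcongr
  have : 0 ≤ K * e := by positivity
  have : 0 ≤ K ^ 2 * e := by positivity
  nlinarith

lemma dball_norm {n : ℕ} {γ : ℝ} {w : En n} (hw : w ∈ Dball (0 : En n) γ) :
    ‖w‖ ≤ 1 - Real.exp (-(2 * γ)) := by
  obtain ⟨h1, h2⟩ := hw
  have hw1 : ‖w‖ < 1 := by simpa [uball] using h1
  have hm : ‖mobius (0 : En n) w‖ = ‖w‖ := by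
    simp [mobius, prj, herm]
  rw [bmet, hm] at h2
  have hpos : 0 < (1 + ‖w‖) / (1 - ‖w‖) := div_pos (by positivity) (by linarith)
  have h3 : Real.log ((1 + ‖w‖) / (1 - ‖w‖)) < 2 * γ := by linarith
  rw [Real.log_lt_iff_lt_exp hpos, div_lt_iff₀ (by linarith)] at h3
  rw [Real.exp_neg]
  have hE := Real.exp_pos (2 * γ)
  have : (Real.exp (2*γ))⁻¹ ≤ 1 - ‖w‖ := by
    rw [inv_le_iff_one_le_mul₀ hE]
    nlinarith [norm_nonneg w]
  linarith

lemma rho_big {n : ℕ} {B : ℝ} (a b : En n) (ha : ‖a‖ ≤ B) (hb : ‖b‖ ≤ B) :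
    rho a b ≤ 2 * B + 2 := by
  unfold rho
  split_ifs with h
  · have h1 : |‖a‖ - ‖b‖| ≤ 2 * B := by
      rw [abs_le]; constructor <;> linarith [norm_nonneg a, norm_nonneg b]
    have h2 : ‖herm a b / ((‖a‖ : ℂ) * (‖b‖ : ℂ))‖ ≤ 1 := by
      rw [norm_div, norm_mul, Complex.norm_real, Complex.norm_real, norm_norm, norm_norm]
      exact div_le_one_of_le₀ (herm_norm_le a b) (by positivity)
    have h3 := norm_sub_le (1:ℂ) (herm a b / ((‖a‖ : ℂ) * (‖b‖ : ℂ)))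
    rw [norm_one] at h3
    linarith
  · linarith

lemma rho_small {n : ℕ} {t : ℝ} (ht : t ≤ 1/2) (a b : En n) (haa : ‖1 - herm a a‖ ≤ t)
    (hbb : ‖1 - herm b b‖ ≤ t) (hab : ‖1 - herm a b‖ ≤ t) : rho a b ≤ 18 * t := by
  have aux : ∀ x : En n, ‖1 - herm x x‖ ≤ t → 1/2 ≤ ‖x‖ ∧ |1 - ‖x‖| ≤ t ∧ ‖x‖ ≤ 3/2 := by
    intro x hx
    rw [herm_self, ← Complex.ofReal_one, ← Complex.ofReal_sub, Complex.norm_real,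
      Real.norm_eq_abs, abs_le] at hx
    have := norm_nonneg x
    have h1 : |1 - ‖x‖| ≤ t := by
      rw [abs_le]; constructor <;> nlinarith
    refine ⟨?_, h1, ?_⟩ <;> rw [abs_le] at h1 <;> linarith
  obtain ⟨a1, a2, a3⟩ := aux a haa
  obtain ⟨b1, b2, b3⟩ := aux b hbb
  have ha0 : a ≠ 0 := by rintro rfl; norm_num at a1
  have hb0 : b ≠ 0 := by rintro rfl; norm_num at b1
  unfold rho
  rw [if_pos ⟨ha0, hb0⟩]
  have h1 : |‖a‖ - ‖b‖| ≤ 2 * t := by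
    rw [abs_le] at *; constructor <;> linarith
  have hna : (‖a‖ : ℂ) ≠ 0 := by exact_mod_cast (norm_ne_zero_iff.mpr ha0)
  have hnb : (‖b‖ : ℂ) ≠ 0 := by exact_mod_cast (norm_ne_zero_iff.mpr hb0)
  have h2 : 1 - herm a b / ((‖a‖ : ℂ) * (‖b‖ : ℂ)) =
      ((1 - herm a b) - ((1 - ‖a‖ * ‖b‖ : ℝ) : ℂ)) / ((‖a‖ : ℂ) * (‖b‖ : ℂ)) := by
    push_cast; field_simp; ring
  have h3 : ‖(1 - herm a b) - ((1 - ‖a‖ * ‖b‖ : ℝ) : ℂ)‖ ≤ 4 * t := by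
    refine (norm_sub_le _ _).trans ?_
    have : |1 - ‖a‖ * ‖b‖| ≤ 3 * t := by
      rw [abs_le] at *; constructor <;> nlinarith
    rw [Complex.norm_real, Real.norm_eq_abs]; linarith
  have h4 : ‖1 - herm a b / ((‖a‖ : ℂ) * (‖b‖ : ℂ))‖ ≤ 16 * t := by
    rw [h2, norm_div, norm_mul, Complex.norm_real, Complex.norm_real, norm_norm, norm_norm,
      div_le_iff₀ (by positivity)]
    have ht0 : 0 ≤ t := (norm_nonneg _).trans hab
    have : 1/4 ≤ ‖a‖ * ‖b‖ := by nlinarith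
    nlinarith
  linarith

/-- For each `γ > 0` there is `C > 0` such that
`ϱ(φ_u(w), φ_ζ(w)) ≤ C |1-⟨u,ζ⟩|` for all `u, ζ ∈ 𝔹ₙ` and `w ∈ D(0,γ)`. -/
theorem stmt18 (n : ℕ) (hn : 1 ≤ n) (γ : ℝ) (hγ : 0 < γ) :
    ∃ C : ℝ, 0 < C ∧ ∀ u ∈ uball n, ∀ ζ ∈ uball n, ∀ w ∈ Dball (0 : En n) γ,
      rho (mobius u w) (mobius ζ w) ≤ C * ‖1 - herm u ζ‖ := by
  set m := Real.exp (-(2 * γ)) with hmdef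
  have hm : 0 < m := Real.exp_pos _
  set K := 4 / m with hKdef
  have hK : 0 < K := by positivity
  set A := 10 * (1 + K) ^ 2 with hA
  have hA1 : 1 ≤ A := by nlinarith
  refine ⟨36 * A + (2 * K + 2) * (4 * A), by positivity, ?_⟩
  intro u hu ζ hζ w hw
  have hu1 : ‖u‖ < 1 := by simpa [uball] using hu
  have hζ1 : ‖ζ‖ < 1 := by simpa [uball] using hζ
  have hwn := dball_norm hw
  rw [← hmdef] at hwn
  set δ := ‖1 - herm u ζ‖ with hδ
  have hδ0 : 0 ≤ δ := norm_nonneg _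
  have hlow : 1 - ‖u‖ * ‖ζ‖ ≤ δ := by
    have h1 : ‖(1:ℂ)‖ - ‖herm u ζ‖ ≤ δ := norm_sub_norm_le _ _
    have h2 := herm_norm_le u ζ
    rw [norm_one] at h1; linarith
  have hun := norm_nonneg u
  have hζn := norm_nonneg ζ
  have hud : 1 - ‖u‖ ≤ δ := by nlinarith
  have hζd : 1 - ‖ζ‖ ≤ δ := by nlinarith
  by_cases hs : A * (2 * δ) ≤ 1/2
  · have hδ4 : δ ≤ 1/4 := by nlinarith
    have hu2 : 1 - ‖u‖ ^ 2 ≤ 2 * δ := by nlinarith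
    have hζ2 : 1 - ‖ζ‖ ^ 2 ≤ 2 * δ := by nlinarith
    have hself : ∀ x : En n, ‖x‖ < 1 → 1 - ‖x‖ ^ 2 ≤ 2 * δ → ‖1 - herm x x‖ ≤ 2 * δ := by
      intro x hx1 hx2
      rw [herm_self, ← Complex.ofReal_one, ← Complex.ofReal_sub, Complex.norm_real,
        Real.norm_of_nonneg (by nlinarith [norm_nonneg x])]
      exact hx2
    obtain ⟨c, p, h1, h2, h3, h4⟩ := mob_decomp hm u w hu1 hwn (by linarith) hu2
    obtain ⟨d, q, k1, k2, k3, k4⟩ := mob_decomp hm ζ w hζ1 hwn (by linarith) hζ2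
    rw [h1, k1]
    have := rho_small hs (c • u - p) (d • ζ - q)
      (key hK (by linarith) (by linarith) u u p p c c hu1 hu1 h2 h2 h3 h3 h4 h4 (hself u hu1 hu2))
      (key hK (by linarith) (by linarith) ζ ζ q q d d hζ1 hζ1 k2 k2 k3 k3 k4 k4 (hself ζ hζ1 hζ2))
      (key hK (by linarith) (by linarith) u ζ p q c d hu1 hζ1 h2 k2 h3 k3 h4 k4 (by linarith))
    have h5 : 0 ≤ (2 * K + 2) * (4 * A) * δ := by positivity
    nlinarith
  · push Not at hs
    have := rho_big _ _ (mob_bound hm u w hu1 hwn) (mob_bound hm ζ w hζ1 hwn)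
    have h5 : 0 ≤ 36 * A * δ := by positivity
    have h6 : (2 * K + 2) * 1 ≤ (2 * K + 2) * (4 * A * δ) := by
      gcongr; linarith
    rw [← hKdef] at this
    nlinarith
end
end
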